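/- arXiv:0706.0049 — 2 statements merged into one kernel-verified Lean document; each statement's English description precedes it below -/
import Mathlib

section
/- Let D be a set of positive processes containing the constant process 1. Then the process polar D^× is a subset of S₁ that is closed under Fatou convergence, (process) solid, and fork-convex. -/
open MeasureTheory Filter Set
open scoped NNReal ENNReal

variable {Ω : Type*}

/-- A real function is càdlàg on `[0,T]`: right-continuous at every `t ∈ [0,T)` and
with left limits at every `t ∈ (0,T]`. -/
def CadlagOn (T : ℝ) (f : ℝ → ℝ) : Prop :=
  (∀ t ∈ Set.Ico (0 : ℝ) T, Filter.Tendsto f (nhdsWithin t (Set.Ioi t)) (nhds (f t))) ∧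
  (∀ t ∈ Set.Ioc (0 : ℝ) T, ∃ L : ℝ, Filter.Tendsto f (nhdsWithin t (Set.Iio t)) (nhds L))

/-- A positive process on `[0,T]`: adapted, nonnegative, with càdlàg paths. -/
def PosProc {m0 : MeasurableSpace Ω} (μ : Measure Ω) (T : ℝ)
    (ℱ : Filtration ℝ m0) (X : ℝ → Ω → ℝ) : Prop :=
  (∀ t ∈ Set.Icc (0 : ℝ) T, StronglyMeasurable[ℱ t] (X t)) ∧
  (∀ᵐ ω ∂μ, ∀ t ∈ Set.Icc (0 : ℝ) T, 0 ≤ X t ω) ∧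
  (∀ᵐ ω ∂μ, CadlagOn T (fun t => X t ω))

/-- A nonnegative càdlàg supermartingale on `[0,T]`. -/
def SuperMG {m0 : MeasurableSpace Ω} (μ : Measure Ω) (T : ℝ)
    (ℱ : Filtration ℝ m0) (X : ℝ → Ω → ℝ) : Prop :=
  PosProc μ T ℱ X ∧ (∀ t ∈ Set.Icc (0 : ℝ) T, Integrable (X t) μ) ∧
  ∀ s t : ℝ, s ∈ Set.Icc (0 : ℝ) T → t ∈ Set.Icc (0 : ℝ) T → s ≤ t →
    μ[X t | ℱ s] ≤ᵐ[μ] X s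

/-- Membership in `S₁`: a nonnegative càdlàg supermartingale with `Y₀ ≤ 1`. -/
def S1mem {m0 : MeasurableSpace Ω} (μ : Measure Ω) (T : ℝ)
    (ℱ : Filtration ℝ m0) (X : ℝ → Ω → ℝ) : Prop :=
  SuperMG μ T ℱ X ∧ ∀ᵐ ω ∂μ, X 0 ω ≤ 1

/-- Membership in `V`: a nonincreasing positive process with `B₀ ≤ 1`. -/
def Vmem {m0 : MeasurableSpace Ω} (μ : Measure Ω) (T : ℝ)
    (ℱ : Filtration ℝ m0) (B : ℝ → Ω → ℝ) : Prop :=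
  PosProc μ T ℱ B ∧
  (∀ᵐ ω ∂μ, ∀ s ∈ Set.Icc (0 : ℝ) T, ∀ t ∈ Set.Icc (0 : ℝ) T, s ≤ t → B t ω ≤ B s ω) ∧
  (∀ᵐ ω ∂μ, B 0 ω ≤ 1)

/-- The process polar `C^×`: all positive processes `Y` such that `XY` is a
supermartingale with `X₀Y₀ ≤ 1` for every `X ∈ C`. -/
def procPolar {m0 : MeasurableSpace Ω} (μ : Measure Ω) (T : ℝ)
    (ℱ : Filtration ℝ m0) (C : Set (ℝ → Ω → ℝ)) : Set (ℝ → Ω → ℝ) :=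
  {Y | PosProc μ T ℱ Y ∧ ∀ X ∈ C,
    SuperMG μ T ℱ (fun t ω => X t ω * Y t ω) ∧ ∀ᵐ ω ∂μ, X 0 ω * Y 0 ω ≤ 1}

/-- (Process) solidity: stability under multiplication by elements of `V`. -/
def ProcSolid {m0 : MeasurableSpace Ω} (μ : Measure Ω) (T : ℝ)
    (ℱ : Filtration ℝ m0) (C : Set (ℝ → Ω → ℝ)) : Prop :=
  ∀ Y ∈ C, ∀ B : ℝ → Ω → ℝ, Vmem μ T ℱ B → (fun t ω => Y t ω * B t ω) ∈ C

/-- Fork-convexity (with the convention `0/0 = 0`, which holds for Lean division). -/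
def ForkConvex {m0 : MeasurableSpace Ω} (μ : Measure Ω) (T : ℝ)
    (ℱ : Filtration ℝ m0) (C : Set (ℝ → Ω → ℝ)) : Prop :=
  ∀ s ∈ Set.Icc (0 : ℝ) T, ∀ h : Ω → ℝ, StronglyMeasurable[ℱ s] h →
    (∀ ω, 0 ≤ h ω) → (∀ ω, h ω ≤ 1) →
    ∀ Y1 ∈ C, ∀ Y2 ∈ C, ∀ Y3 ∈ C,
      (fun t ω => if t < s then Y1 t ω
        else Y1 s ω * (h ω * (Y2 t ω / Y2 s ω) + (1 - h ω) * (Y3 t ω / Y3 s ω))) ∈ C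

/-- Fatou convergence of a sequence of positive processes. -/
def FatouConv {m0 : MeasurableSpace Ω} (μ : Measure Ω) (T : ℝ) (Yn : ℕ → ℝ → Ω → ℝ) (Y : ℝ → Ω → ℝ) : Prop :=
  ∃ T' : Set ℝ, T'.Countable ∧ T' ⊆ Set.Icc 0 T ∧ Set.Icc (0 : ℝ) T ⊆ closure T' ∧
    ∀ᵐ ω ∂μ,
      (∀ t ∈ Set.Ico (0 : ℝ) T,
        (ENNReal.ofReal (Y t ω)
            = Filter.liminf
                (fun s => Filter.liminf (fun n => ENNReal.ofReal (Yn n s ω)) Filter.atTop)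
                (nhdsWithin t (Set.Ioi t ∩ T')) ∧
         ENNReal.ofReal (Y t ω)
            = Filter.limsup
                (fun s => Filter.limsup (fun n => ENNReal.ofReal (Yn n s ω)) Filter.atTop)
                (nhdsWithin t (Set.Ioi t ∩ T')))) ∧
      Filter.Tendsto (fun n => Yn n T ω) Filter.atTop (nhds (Y T ω))

/-- Closedness under Fatou convergence. -/
def FatouClosed {m0 : MeasurableSpace Ω} (μ : Measure Ω) (T : ℝ)
    (ℱ : Filtration ℝ m0) (C : Set (ℝ → Ω → ℝ)) : Prop :=
  ∀ (Yn : ℕ → ℝ → Ω → ℝ) (Y : ℝ → Ω → ℝ), (∀ n, Yn n ∈ C) → PosProc μ T ℱ Y →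
    FatouConv μ T Yn Y → Y ∈ C

/-- A set of processes is far-reaching if it has an element with `Y_T > 0` a.s. -/
def FarReaching {m0 : MeasurableSpace Ω} (μ : Measure Ω) (T : ℝ) (C : Set (ℝ → Ω → ℝ)) : Prop :=
  ∃ Y ∈ C, ∀ᵐ ω ∂μ, 0 < Y T ω

/-- The solid, fork-convex hull of `C`: the smallest (process) solid and fork-convex
subset of `S₁` containing `C`. -/
def solidForkHull {m0 : MeasurableSpace Ω} (μ : Measure Ω) (T : ℝ)
    (ℱ : Filtration ℝ m0) (C : Set (ℝ → Ω → ℝ)) : Set (ℝ → Ω → ℝ) :=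
  ⋂₀ {D | D ⊆ {X | S1mem μ T ℱ X} ∧ ProcSolid μ T ℱ D ∧ ForkConvex μ T ℱ D ∧ C ⊆ D}

/-- Extended (`[0,∞]`-valued) conditional expectation of a (nonnegative) function,
defined as the supremum of the conditional expectations of its truncations. -/
noncomputable def econd {mΩ : MeasurableSpace Ω} (μ : Measure Ω)
    (m : MeasurableSpace Ω) (f : Ω → ℝ) : Ω → ℝ≥0∞ :=
  fun ω => ⨆ n : ℕ, ENNReal.ofReal ((μ[fun ω' => min (f ω') n | m]) ω)

/-- `f` is dominated by `g` in conditional mean given `m`: its integral over every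
`m`-measurable set is at most that of `g`. -/
def CondLE {m0 : MeasurableSpace Ω} (μ : Measure Ω) (m : MeasurableSpace Ω) (f g : Ω → ℝ≥0∞) :
    Prop :=
  ∀ A, MeasurableSet[m] A → ∫⁻ ω in A, f ω ∂μ ≤ ∫⁻ ω in A, g ω ∂μ

namespace CondLE

theorem of_ae_le {m m0 : MeasurableSpace Ω} {μ : Measure Ω} {f g : Ω → ℝ≥0∞}
    (h : f ≤ᵐ[μ] g) : CondLE μ m f g :=
  fun _ _ => lintegral_mono_ae (ae_restrict_of_ae h)

theorem trans {m m0 : MeasurableSpace Ω} {μ : Measure Ω} {f g k : Ω → ℝ≥0∞}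
    (h₁ : CondLE μ m f g) (h₂ : CondLE μ m g k) : CondLE μ m f k :=
  fun A hA => (h₁ A hA).trans (h₂ A hA)

theorem mono_sigma {m m' m0 : MeasurableSpace Ω} {μ : Measure Ω} {f g : Ω → ℝ≥0∞}
    (h : CondLE μ m' f g) (hm : m ≤ m') : CondLE μ m f g :=
  fun A hA => h A (hm A hA)

theorem iff_condLExp_le {m m0 : MeasurableSpace Ω} {μ : Measure Ω} [IsFiniteMeasure μ]
    (hm : m ≤ m0) {f g : Ω → ℝ≥0∞} (hg : Measurable[m] g) :
    CondLE μ m f g ↔ μ⁻[f|m] ≤ᵐ[μ] g := by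
  constructor
  · intro h
    apply ae_le_of_ae_le_trim (hm := hm)
    refine ae_le_of_forall_setLIntegral_le_of_sigmaFinite (measurable_condLExp m μ f)
      fun A hA _ => ?_
    rw [setLIntegral_condLExp_trim hm μ f hA, setLIntegral_trim hm hg hA]
    exact h A hA
  · intro h A hA
    rw [← setLIntegral_condLExp hm μ f hA]
    exact lintegral_mono_ae (ae_restrict_of_ae h)

theorem iInf {m m0 : MeasurableSpace Ω} {μ : Measure Ω} [IsFiniteMeasure μ] {ι : Type*}
    [Countable ι] (hm : m ≤ m0) {f g : ι → Ω → ℝ≥0∞} (hg : ∀ i, Measurable[m] (g i))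
    (h : ∀ i, CondLE μ m (f i) (g i)) :
    CondLE μ m (fun ω => ⨅ i, f i ω) (fun ω => ⨅ i, g i ω) := by
  rw [iff_condLExp_le hm (Measurable.iInf hg)]
  have h' : ∀ i, μ⁻[fun ω => ⨅ i, f i ω|m] ≤ᵐ[μ] g i := fun i =>
    (condLExp_mono (mΩ := m) (ae_of_all _ fun ω => iInf_le _ i)).trans ((iff_condLExp_le hm (hg i)).1 (h i))
  filter_upwards [ae_all_iff.2 h'] with ω hω using le_iInf hω

theorem min_const {m m0 : MeasurableSpace Ω} {μ : Measure Ω} [IsFiniteMeasure μ]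
    (hm : m ≤ m0) {f g : Ω → ℝ≥0∞} (hg : Measurable[m] g) (h : CondLE μ m f g) (c : ℝ≥0∞) :
    CondLE μ m (fun ω => min (f ω) c) (fun ω => min (g ω) c) := by
  rw [iff_condLExp_le hm (hg.min measurable_const)]
  have h₁ := (condLExp_mono (mΩ := m) (ae_of_all μ fun ω => min_le_left (f ω) c)).trans
    ((iff_condLExp_le hm hg).1 h)
  have h₂ := condLExp_mono (mΩ := m) (ae_of_all μ fun ω => min_le_right (f ω) c)
  rw [condLExp_const hm] at h₂
  filter_upwards [h₁, h₂] with ω hω₁ hω₂ using le_min hω₁ hω₂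

theorem liminf {m m0 : MeasurableSpace Ω} {μ : Measure Ω} [IsFiniteMeasure μ]
    (hm : m ≤ m0) {f g : ℕ → Ω → ℝ≥0∞} (hf : ∀ n, Measurable (f n))
    (hg : ∀ n, Measurable[m] (g n)) (h : ∀ n, CondLE μ m (f n) (g n)) :
    CondLE μ m (fun ω => Filter.liminf (fun n => f n ω) atTop)
      (fun ω => Filter.liminf (fun n => g n ω) atTop) := by
  intro A hA
  simp only [liminf_eq_iSup_iInf_of_nat']
  rw [lintegral_iSup (fun n => Measurable.iInf fun i => hf _)]
  · refine iSup_le fun n => ((iInf hm (fun i => hg (i + n)) fun i => h (i + n)) A hA).trans ?_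
    exact lintegral_mono fun ω => le_iSup (fun n => ⨅ i, g (i + n) ω) n
  · intro n k hnk ω
    refine le_iInf fun i => (iInf_le _ (i + (k - n))).trans_eq ?_
    have hnk : n ≤ k := hnk
    dsimp only
    rw [show i + (k - n) + n = i + k by omega]

theorem mul_left {m m0 : MeasurableSpace Ω} {μ : Measure Ω} (hm : m ≤ m0) {f g b : Ω → ℝ≥0∞}
    (hf : Measurable f) (hg : Measurable g) (hb : Measurable[m] b) (h : CondLE μ m f g) :
    CondLE μ m (fun ω => b ω * f ω) (fun ω => b ω * g ω) := by
  intro A hA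
  have key : (μ.withDensity f).trim hm ≤ (μ.withDensity g).trim hm := by
    refine Measure.le_iff.2 fun B hB => ?_
    rw [trim_measurableSet_eq hm hB, trim_measurableSet_eq hm hB, withDensity_apply _ (hm _ hB),
      withDensity_apply _ (hm _ hB)]
    exact h B hB
  have eq : ∀ k : Ω → ℝ≥0∞, Measurable k →
      ∫⁻ ω in A, b ω * k ω ∂μ = ∫⁻ ω in A, b ω ∂(μ.withDensity k).trim hm := by
    intro k hk
    rw [setLIntegral_trim hm hb hA, setLIntegral_withDensity_eq_setLIntegral_mul μ hk
      (hb.mono hm le_rfl) (hm _ hA)]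
    exact lintegral_congr fun ω => mul_comm _ _
  rw [eq f hf, eq g hg]
  exact lintegral_mono' (Measure.restrict_mono le_rfl key) le_rfl

theorem add {m m0 : MeasurableSpace Ω} {μ : Measure Ω} {f g f' g' : Ω → ℝ≥0∞}
    (hf : Measurable f) (hg : Measurable g) (h : CondLE μ m f g) (h' : CondLE μ m f' g') :
    CondLE μ m (fun ω => f ω + f' ω) (fun ω => g ω + g' ω) := by
  intro A hA
  rw [lintegral_add_left hf, lintegral_add_left hg]
  exact add_le_add (h A hA) (h' A hA)

theorem of_tendsto_left {ι : Type*} {m m0 : MeasurableSpace Ω} {μ : Measure Ω} {l : Filter ι}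
    [l.NeBot] [l.IsCountablyGenerated] {F : ι → Ω → ℝ≥0∞} {f g : Ω → ℝ≥0∞}
    (hF : ∀ᶠ i in l, Measurable (F i)) (hlim : ∀ᵐ ω ∂μ, Tendsto (fun i => F i ω) l (nhds (f ω)))
    (h : ∀ᶠ i in l, CondLE μ m (F i) g) : CondLE μ m f g := by
  intro A hA
  obtain ⟨u, hu⟩ := l.exists_seq_tendsto
  obtain ⟨N, hN⟩ := eventually_atTop.1 (hu.eventually (hF.and h))
  have hu' : Tendsto (fun n => u (n + N)) atTop l := hu.comp (tendsto_add_atTop_nat N)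
  calc ∫⁻ ω in A, f ω ∂μ
      = ∫⁻ ω in A, Filter.liminf (fun n => F (u (n + N)) ω) atTop ∂μ :=
        lintegral_congr_ae (ae_restrict_of_ae
          (hlim.mono fun ω hω => (hω.comp hu').liminf_eq.symm))
    _ ≤ Filter.liminf (fun n => ∫⁻ ω in A, F (u (n + N)) ω ∂μ) atTop :=
        lintegral_liminf_le fun n => (hN (n + N) (Nat.le_add_left _ _)).1
    _ ≤ Filter.liminf (fun _ : ℕ => ∫⁻ ω in A, g ω ∂μ) atTop :=
        liminf_le_liminf (Eventually.of_forall fun n =>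
          (hN (n + N) (Nat.le_add_left _ _)).2 A hA)
    _ = ∫⁻ ω in A, g ω ∂μ := liminf_const _

theorem of_tendsto_right {ι : Type*} {m m0 : MeasurableSpace Ω} {μ : Measure Ω}
    [IsFiniteMeasure μ] {l : Filter ι} [l.NeBot] [l.IsCountablyGenerated] {M : ι → MeasurableSpace Ω}
    {G : ι → Ω → ℝ≥0∞} {f g : Ω → ℝ≥0∞} (hf : Measurable f)
    (hM : ∀ᶠ i in l, m ≤ M i ∧ M i ≤ m0 ∧ Measurable[M i] (G i))
    (hlim : ∀ᵐ ω ∂μ, Tendsto (fun i => G i ω) l (nhds (g ω)))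
    (h : ∀ᶠ i in l, CondLE μ (M i) f (G i)) : CondLE μ m f g := by
  intro A hA
  have trunc : ∀ c : ℕ, ∫⁻ ω in A, min (f ω) c ∂μ ≤ ∫⁻ ω in A, g ω ∂μ := by
    intro c
    have hconv : Tendsto (fun i => ∫⁻ ω in A, min (G i ω) c ∂μ) l
        (nhds (∫⁻ ω in A, min (g ω) c ∂μ)) := by
      refine tendsto_lintegral_filter_of_dominated_convergence (fun _ => (c : ℝ≥0∞)) ?_ ?_ ?_ ?_
      · filter_upwards [hM] with i hi
        exact (hi.2.2.mono hi.2.1 le_rfl).min measurable_const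
      · exact Eventually.of_forall fun i => ae_of_all _ fun ω => min_le_right _ _
      · simpa using ENNReal.mul_ne_top (ENNReal.natCast_ne_top c) (measure_ne_top _ _)
      · exact ae_restrict_of_ae (hlim.mono fun ω hω => hω.min tendsto_const_nhds)
    have hle : ∫⁻ ω in A, min (f ω) c ∂μ ≤ ∫⁻ ω in A, min (g ω) c ∂μ := by
      refine ge_of_tendsto hconv ?_
      filter_upwards [hM, h] with i hi hi'
      exact hi'.min_const hi.2.1 hi.2.2 c A (hi.1 A hA)
    exact hle.trans (lintegral_mono fun ω => min_le_left _ _)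
  have hsup : ∀ ω, f ω = ⨆ c : ℕ, min (f ω) c := by
    intro ω
    rw [← inf_iSup_eq, ENNReal.iSup_natCast, inf_top_eq]
  calc ∫⁻ ω in A, f ω ∂μ = ∫⁻ ω in A, ⨆ c : ℕ, min (f ω) c ∂μ := lintegral_congr hsup
    _ = ⨆ c : ℕ, ∫⁻ ω in A, min (f ω) c ∂μ :=
        lintegral_iSup (fun c => hf.min measurable_const)
          fun a b hab ω => min_le_min le_rfl (Nat.cast_le.2 hab)
    _ ≤ ∫⁻ ω in A, g ω ∂μ := iSup_le trunc

end CondLE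

theorem CadlagOn.mul {T : ℝ} {f g : ℝ → ℝ} (hf : CadlagOn T f) (hg : CadlagOn T g) :
    CadlagOn T (fun t => f t * g t) := by
  refine ⟨fun t ht => (hf.1 t ht).mul (hg.1 t ht), fun t ht => ?_⟩
  obtain ⟨a, ha⟩ := hf.2 t ht
  obtain ⟨b, hb⟩ := hg.2 t ht
  exact ⟨a * b, ha.mul hb⟩

theorem PosProc.mul {m0 : MeasurableSpace Ω} {μ : Measure Ω} {T : ℝ} {ℱ : Filtration ℝ m0}
    {X Y : ℝ → Ω → ℝ} (hX : PosProc μ T ℱ X) (hY : PosProc μ T ℱ Y) :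
    PosProc μ T ℱ (fun t ω => X t ω * Y t ω) := by
  refine ⟨fun t ht => (hX.1 t ht).mul (hY.1 t ht), ?_, ?_⟩
  · filter_upwards [hX.2.1, hY.2.1] with ω h₁ h₂ t ht using mul_nonneg (h₁ t ht) (h₂ t ht)
  · filter_upwards [hX.2.2, hY.2.2] with ω h₁ h₂ using h₁.mul h₂

theorem PosProc.measurable_ofReal {m0 : MeasurableSpace Ω} {μ : Measure Ω} {T : ℝ}
    {ℱ : Filtration ℝ m0} {X : ℝ → Ω → ℝ} (hX : PosProc μ T ℱ X) {t : ℝ}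
    (ht : t ∈ Set.Icc (0 : ℝ) T) : Measurable[ℱ t] (fun ω => ENNReal.ofReal (X t ω)) :=
  ENNReal.measurable_ofReal.comp (hX.1 t ht).measurable

theorem SuperMG.condLE {m0 : MeasurableSpace Ω} {μ : Measure Ω} [IsFiniteMeasure μ] {T : ℝ}
    {ℱ : Filtration ℝ m0} {Z : ℝ → Ω → ℝ} (hZ : SuperMG μ T ℱ Z) {s t : ℝ}
    (hs : s ∈ Set.Icc (0 : ℝ) T) (ht : t ∈ Set.Icc (0 : ℝ) T) (hst : s ≤ t) :
    CondLE μ (ℱ s) (fun ω => ENNReal.ofReal (Z t ω)) (fun ω => ENNReal.ofReal (Z s ω)) := by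
  rw [CondLE.iff_condLExp_le (ℱ.le s) (hZ.1.measurable_ofReal hs)]
  have hpos : 0 ≤ᵐ[μ] Z t := hZ.1.2.1.mono fun ω hω => hω t ht
  filter_upwards [condLExp_ofReal (ℱ s) (hZ.2.1 t ht) hpos, hZ.2.2 s t hs ht hst] with ω h₁ h₂
  rw [h₁]
  exact ENNReal.ofReal_le_ofReal h₂

theorem PosProc.superMG_of_condLE {m0 : MeasurableSpace Ω} {μ : Measure Ω} [IsFiniteMeasure μ]
    {T : ℝ} {ℱ : Filtration ℝ m0} {Z : ℝ → Ω → ℝ} (hZ : PosProc μ T ℱ Z)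
    (h0 : ∀ᵐ ω ∂μ, Z 0 ω ≤ 1)
    (h : ∀ s t : ℝ, s ∈ Set.Icc (0 : ℝ) T → t ∈ Set.Icc (0 : ℝ) T → s ≤ t →
      CondLE μ (ℱ s) (fun ω => ENNReal.ofReal (Z t ω)) (fun ω => ENNReal.ofReal (Z s ω))) :
    SuperMG μ T ℱ Z := by
  have hpos : ∀ t ∈ Set.Icc (0 : ℝ) T, 0 ≤ᵐ[μ] Z t := fun t ht => hZ.2.1.mono fun ω hω => hω t ht
  have hint : ∀ t ∈ Set.Icc (0 : ℝ) T, Integrable (Z t) μ := by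
    intro t ht
    refine ⟨((hZ.1 t ht).mono (ℱ.le t)).aestronglyMeasurable, ?_⟩
    rw [hasFiniteIntegral_iff_ofReal (hpos t ht)]
    have h0T : (0 : ℝ) ∈ Set.Icc (0 : ℝ) T := ⟨le_rfl, ht.1.trans ht.2⟩
    have h1 := h 0 t h0T ht ht.1 Set.univ MeasurableSet.univ
    rw [setLIntegral_univ, setLIntegral_univ] at h1
    refine (h1.trans (lintegral_mono_ae (g := fun _ => 1) ?_)).trans_lt (by simp)
    exact h0.mono fun ω hω => by simpa using ENNReal.ofReal_le_ofReal hω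
  refine ⟨hZ, hint, fun s t hs ht hst => ?_⟩
  have h1 := (CondLE.iff_condLExp_le (ℱ.le s) (hZ.measurable_ofReal hs)).1 (h s t hs ht hst)
  filter_upwards [condLExp_ofReal (ℱ s) (hint t ht) (hpos t ht), h1, hpos s hs] with ω h₁ h₂ h₃
  rw [h₁] at h₂
  exact (ENNReal.ofReal_le_ofReal_iff h₃).1 h₂

/-- Membership in the process polar in terms of conditional domination. -/
theorem mem_procPolar_iff {m0 : MeasurableSpace Ω} {μ : Measure Ω} [IsFiniteMeasure μ] {T : ℝ}
    {ℱ : Filtration ℝ m0} {D : Set (ℝ → Ω → ℝ)} (hD : ∀ X ∈ D, PosProc μ T ℱ X)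
    {Y : ℝ → Ω → ℝ} :
    Y ∈ procPolar μ T ℱ D ↔ PosProc μ T ℱ Y ∧ ∀ X ∈ D, (∀ᵐ ω ∂μ, X 0 ω * Y 0 ω ≤ 1) ∧
      ∀ s t : ℝ, s ∈ Set.Icc (0 : ℝ) T → t ∈ Set.Icc (0 : ℝ) T → s ≤ t →
        CondLE μ (ℱ s) (fun ω => ENNReal.ofReal (X t ω * Y t ω))
          (fun ω => ENNReal.ofReal (X s ω * Y s ω)) :=
  ⟨fun h => ⟨h.1, fun X hX => ⟨(h.2 X hX).2, fun _ _ hs ht hst => (h.2 X hX).1.condLE hs ht hst⟩⟩,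
    fun h => ⟨h.1, fun X hX =>
      ⟨((hD X hX).mul h.1).superMG_of_condLE (h.2 X hX).1 (h.2 X hX).2, (h.2 X hX).1⟩⟩⟩

theorem procPolar_subset_S1 {m0 : MeasurableSpace Ω} {μ : Measure Ω} {T : ℝ}
    {ℱ : Filtration ℝ m0} {D : Set (ℝ → Ω → ℝ)} (h1 : (fun _ _ => (1 : ℝ)) ∈ D) :
    procPolar μ T ℱ D ⊆ {X | S1mem μ T ℱ X} := fun Y hY => by
  simpa [S1mem] using hY.2 _ h1

theorem procSolid_procPolar {m0 : MeasurableSpace Ω} {μ : Measure Ω} [IsFiniteMeasure μ] {T : ℝ}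
    (hT : 0 ≤ T) {ℱ : Filtration ℝ m0} {D : Set (ℝ → Ω → ℝ)} (hD : ∀ X ∈ D, PosProc μ T ℱ X) :
    ProcSolid μ T ℱ (procPolar μ T ℱ D) := by
  intro Y hY B ⟨hB, hanti, hB0⟩
  rw [mem_procPolar_iff hD] at hY ⊢
  have h0T : (0 : ℝ) ∈ Set.Icc (0 : ℝ) T := ⟨le_rfl, hT⟩
  refine ⟨hY.1.mul hB, fun X hX => ⟨?_, fun s t hs ht hst => ?_⟩⟩
  · filter_upwards [(hY.2 X hX).1, hB0, hB.2.1] with ω h₁ h₂ h₃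
    rw [← mul_assoc]
    exact mul_le_one₀ h₁ (h₃ 0 h0T) h₂
  · have hXY := (hD X hX).mul hY.1
    refine CondLE.trans (CondLE.of_ae_le ?_)
      ((((hY.2 X hX).2 s t hs ht hst).mul_left (ℱ.le s)
        ((hXY.measurable_ofReal ht).mono (ℱ.le t) le_rfl)
        ((hXY.measurable_ofReal hs).mono (ℱ.le s) le_rfl) (hB.measurable_ofReal hs)).trans
        (CondLE.of_ae_le ?_))
    · filter_upwards [hanti, hXY.2.1, hB.2.1] with ω h₁ h₂ h₃
      rw [← ENNReal.ofReal_mul (h₃ s hs)]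
      refine ENNReal.ofReal_le_ofReal ?_
      rw [← mul_assoc, mul_comm]
      exact mul_le_mul_of_nonneg_right (h₁ s hs t ht hst) (h₂ t ht)
    · filter_upwards [hB.2.1] with ω h₃
      rw [← ENNReal.ofReal_mul (h₃ s hs)]
      exact (congrArg ENNReal.ofReal (by ring)).le

theorem nhdsWithin_Ioi_inter_neBot {T : ℝ} {T' : Set ℝ} (hd : Set.Icc (0 : ℝ) T ⊆ closure T')
    {t : ℝ} (ht : t ∈ Set.Ico (0 : ℝ) T) : (nhdsWithin t (Set.Ioi t ∩ T')).NeBot := by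
  rw [← mem_closure_iff_nhdsWithin_neBot, Metric.mem_closure_iff]
  intro ε hε
  have hlt : t < min (t + ε) T := lt_min (by linarith) ht.2
  obtain ⟨c, hc⟩ := exists_between hlt
  obtain ⟨d, hd₁, hd₂⟩ := mem_closure_iff.1
    (hd ⟨ht.1.trans hc.1.le, (hc.2.trans_le (min_le_right _ _)).le⟩)
    (Set.Ioo t (min (t + ε) T)) isOpen_Ioo hc
  refine ⟨d, ⟨hd₁.1, hd₂⟩, ?_⟩
  rw [Real.dist_eq, abs_sub_comm, abs_of_pos (sub_pos.2 hd₁.1)]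
  linarith [hd₁.2.trans_le (min_le_left _ _)]

/-- Along a suitable filter of times decreasing to `t`, the lower limits of a Fatou convergent
sequence converge to the Fatou limit, also after multiplication by a càdlàg process. -/
theorem FatouConv.exists_filter {m0 : MeasurableSpace Ω} {μ : Measure Ω} {T : ℝ}
    {ℱ : Filtration ℝ m0} {Yn : ℕ → ℝ → Ω → ℝ} {X Y : ℝ → Ω → ℝ} (h : FatouConv μ T Yn Y)
    (hX : PosProc μ T ℱ X) {t : ℝ} (ht : t ∈ Set.Icc (0 : ℝ) T) :
    ∃ l : Filter ℝ, l.NeBot ∧ l.IsCountablyGenerated ∧ (∀ᶠ u in l, u ∈ Set.Icc t T) ∧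
      (∀ r, t < r → ∀ᶠ u in l, u < r) ∧
      ∀ᵐ ω ∂μ, Tendsto (fun u => Filter.liminf (fun n => ENNReal.ofReal (X u ω * Yn n u ω)) atTop)
        l (nhds (ENNReal.ofReal (X t ω * Y t ω))) := by
  obtain ⟨T', -, hsub, hdense, hconv⟩ := h
  rcases ht.2.lt_or_eq with htT | rfl
  · have htI : t ∈ Set.Ico (0 : ℝ) T := ⟨ht.1, htT⟩
    have hmem : ∀ᶠ u in nhdsWithin t (Set.Ioi t ∩ T'), u ∈ Set.Ioi t ∩ T' :=
      self_mem_nhdsWithin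
    have hneBot := nhdsWithin_Ioi_inter_neBot hdense htI
    refine ⟨nhdsWithin t (Set.Ioi t ∩ T'), hneBot, inferInstance, ?_, ?_, ?_⟩
    · exact hmem.mono fun u hu => ⟨le_of_lt hu.1, (hsub hu.2).2⟩
    · exact fun r hr => nhdsWithin_le_nhds (Iio_mem_nhds hr)
    · filter_upwards [hconv, hX.2.1, hX.2.2] with ω hω hpos hcad
      obtain ⟨hinf, hsup⟩ := hω.1 t htI
      have hY : Tendsto (fun u => Filter.liminf (fun n => ENNReal.ofReal (Yn n u ω)) atTop)
          (nhdsWithin t (Set.Ioi t ∩ T')) (nhds (ENNReal.ofReal (Y t ω))) := by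
        refine tendsto_of_le_liminf_of_limsup_le hinf.le (le_trans ?_ hsup.ge)
        exact limsup_le_limsup (Eventually.of_forall fun u => liminf_le_limsup)
      have hXt : Tendsto (fun u => ENNReal.ofReal (X u ω)) (nhdsWithin t (Set.Ioi t ∩ T'))
          (nhds (ENNReal.ofReal (X t ω))) :=
        ENNReal.tendsto_ofReal ((hcad.1 t htI).mono_left (nhdsWithin_mono _ inter_subset_left))
      rw [ENNReal.ofReal_mul (hpos t ht)]
      refine (ENNReal.Tendsto.mul hXt (Or.inr ENNReal.ofReal_ne_top) hY
        (Or.inr ENNReal.ofReal_ne_top)).congr' ?_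
      filter_upwards [hmem] with u hu
      simp_rw [ENNReal.ofReal_mul (hpos u (hsub hu.2))]
      exact (ENNReal.liminf_const_mul_of_ne_top ENNReal.ofReal_ne_top).symm
  · refine ⟨pure t, inferInstance, inferInstance, by simp, fun r hr => by simpa using hr, ?_⟩
    filter_upwards [hconv] with ω hω
    rw [(ENNReal.tendsto_ofReal (hω.2.const_mul (X t ω))).liminf_eq.symm]
    exact tendsto_pure_nhds _ _

theorem fatouClosed_procPolar {m0 : MeasurableSpace Ω} {μ : Measure Ω} [IsFiniteMeasure μ] {T : ℝ}
    (hT : 0 ≤ T) {ℱ : Filtration ℝ m0} {D : Set (ℝ → Ω → ℝ)} (hD : ∀ X ∈ D, PosProc μ T ℱ X) :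
    FatouClosed μ T ℱ (procPolar μ T ℱ D) := by
  intro Yn Y hYn hY hconv
  rw [mem_procPolar_iff hD]
  refine ⟨hY, fun X hX => ?_⟩
  have hYn := fun n => (mem_procPolar_iff hD).1 (hYn n)
  have h0T : (0 : ℝ) ∈ Set.Icc (0 : ℝ) T := ⟨le_rfl, hT⟩
  have hZ := fun n => (hD X hX).mul (hYn n).1
  have hXY := (hD X hX).mul hY
  set L : ℝ → Ω → ℝ≥0∞ :=
    fun u ω => Filter.liminf (fun n => ENNReal.ofReal (X u ω * Yn n u ω)) atTop with hL
  have hLmeas : ∀ u ∈ Set.Icc (0 : ℝ) T, Measurable[ℱ u] (L u) := fun u hu =>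
    Measurable.liminf fun n => (hZ n).measurable_ofReal hu
  have hLmeas' : ∀ u ∈ Set.Icc (0 : ℝ) T, Measurable (L u) := fun u hu =>
    (hLmeas u hu).mono (ℱ.le u) le_rfl
  have hLsuper : ∀ u v : ℝ, u ∈ Set.Icc (0 : ℝ) T → v ∈ Set.Icc (0 : ℝ) T → u ≤ v →
      CondLE μ (ℱ u) (L v) (L u) := fun u v hu hv huv =>
    CondLE.liminf (ℱ.le u) (fun n => ((hZ n).measurable_ofReal hv).mono (ℱ.le v) le_rfl)
      (fun n => (hZ n).measurable_ofReal hu) fun n => ((hYn n).2 X hX).2 u v hu hv huv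
  have hLone : ∀ u ∈ Set.Icc (0 : ℝ) T, CondLE μ (ℱ 0) (L u) (fun _ => 1) := by
    intro u hu
    refine (hLsuper 0 u h0T hu hu.1).trans (CondLE.of_ae_le ?_)
    filter_upwards [ae_all_iff.2 fun n => ((hYn n).2 X hX).1] with ω hω
    refine (liminf_le_liminf (v := fun _ : ℕ => (1 : ℝ≥0∞)) (Eventually.of_forall fun n => ?_)).trans
      (liminf_const _).le
    simpa using ENNReal.ofReal_le_ofReal (hω n)
  constructor
  · obtain ⟨l, _, _, hlI, -, hlim⟩ := hconv.exists_filter (hD X hX) h0T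
    have h := (CondLE.of_tendsto_left (hlI.mono fun u hu => hLmeas' u hu) hlim
      (hlI.mono fun u hu => hLone u hu))
    rw [CondLE.iff_condLExp_le (ℱ.le 0) measurable_const,
      condLExp_eq_self (ℱ.le 0) μ (hXY.measurable_ofReal h0T)] at h
    filter_upwards [h] with ω hω using ENNReal.ofReal_le_one.1 hω
  · intro s t hs ht hst
    rcases hst.eq_or_lt with rfl | hst
    · exact CondLE.of_ae_le (EventuallyLE.refl _ _)
    obtain ⟨l, _, _, hlI, hlr, hlim⟩ := hconv.exists_filter (hD X hX) hs
    obtain ⟨l', _, _, hlI', -, hlim'⟩ := hconv.exists_filter (hD X hX) ht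
    refine CondLE.of_tendsto_right (M := fun u => ℱ u)
      ((hXY.measurable_ofReal ht).mono (ℱ.le t) le_rfl) ?_ hlim ?_
    · filter_upwards [hlI] with u hu
      exact ⟨ℱ.mono hu.1, ℱ.le u, hLmeas u ⟨hs.1.trans hu.1, hu.2⟩⟩
    · filter_upwards [hlI, hlr t hst] with u hu hut
      refine CondLE.of_tendsto_left (hlI'.mono fun v hv => hLmeas' v ⟨ht.1.trans hv.1, hv.2⟩) hlim'
        (hlI'.mono fun v hv => ?_)
      exact hLsuper u v ⟨hs.1.trans hu.1, hu.2⟩ ⟨ht.1.trans hv.1, hv.2⟩ (hut.le.trans hv.1)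

theorem CadlagOn.ite_lt {T : ℝ} {f g : ℝ → ℝ} (hf : CadlagOn T f) (hg : CadlagOn T g) (s : ℝ) :
    CadlagOn T (fun t => if t < s then f t else g t) := by
  refine ⟨fun t ht => ?_, fun t ht => ?_⟩
  · by_cases hts : t < s
    · simp only [hts, if_true]
      refine (hf.1 t ht).congr' ?_
      filter_upwards [nhdsWithin_le_nhds (Iio_mem_nhds hts)] with u hu
      exact (if_pos hu).symm
    · simp only [hts, if_false]
      refine (hg.1 t ht).congr' ?_
      filter_upwards [self_mem_nhdsWithin] with u hu
      exact (if_neg ((not_lt.1 hts).trans_lt hu).not_gt).symm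
  · rcases le_or_gt t s with hts | hts
    · obtain ⟨a, ha⟩ := hf.2 t ht
      refine ⟨a, ha.congr' ?_⟩
      filter_upwards [self_mem_nhdsWithin] with u hu
      exact (if_pos (lt_of_lt_of_le hu hts)).symm
    · obtain ⟨a, ha⟩ := hg.2 t ht
      refine ⟨a, ha.congr' ?_⟩
      filter_upwards [nhdsWithin_le_nhds (Ioi_mem_nhds hts)] with u hu
      exact (if_neg (lt_asymm hu)).symm

theorem CadlagOn.linear_comb {T : ℝ} {f g : ℝ → ℝ} (hf : CadlagOn T f) (hg : CadlagOn T g)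
    (a b : ℝ) : CadlagOn T (fun t => a * f t + b * g t) := by
  refine ⟨fun t ht => ((hf.1 t ht).const_mul a).add ((hg.1 t ht).const_mul b), fun t ht => ?_⟩
  obtain ⟨p, hp⟩ := hf.2 t ht
  obtain ⟨q, hq⟩ := hg.2 t ht
  exact ⟨a * p + b * q, (hp.const_mul a).add (hq.const_mul b)⟩

theorem PosProc.fork {m0 : MeasurableSpace Ω} {μ : Measure Ω} {T : ℝ} {ℱ : Filtration ℝ m0}
    {Y1 Y2 Y3 : ℝ → Ω → ℝ} (hY1 : PosProc μ T ℱ Y1) (hY2 : PosProc μ T ℱ Y2)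
    (hY3 : PosProc μ T ℱ Y3) {s : ℝ} {a b : Ω → ℝ}
    (ha : StronglyMeasurable[ℱ s] a) (hb : StronglyMeasurable[ℱ s] b)
    (ha0 : 0 ≤ᵐ[μ] a) (hb0 : 0 ≤ᵐ[μ] b) :
    PosProc μ T ℱ (fun t ω => if t < s then Y1 t ω else a ω * Y2 t ω + b ω * Y3 t ω) := by
  refine ⟨fun t ht => ?_, ?_, ?_⟩
  · by_cases hts : t < s
    · simpa only [hts, if_true] using hY1.1 t ht
    · simp only [hts, if_false]
      have hst := ℱ.mono (not_lt.1 hts)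
      exact ((ha.mono hst).mul (hY2.1 t ht)).add ((hb.mono hst).mul (hY3.1 t ht))
  · filter_upwards [hY1.2.1, hY2.2.1, hY3.2.1, ha0, hb0] with ω h₁ h₂ h₃ h₄ h₅ t ht
    split_ifs
    · exact h₁ t ht
    · exact add_nonneg (mul_nonneg h₄ (h₂ t ht)) (mul_nonneg h₅ (h₃ t ht))
  · filter_upwards [hY1.2.2, hY2.2.2, hY3.2.2] with ω h₁ h₂ h₃
    exact h₁.ite_lt (h₂.linear_comb h₃ _ _) s

theorem forkConvex_procPolar {m0 : MeasurableSpace Ω} {μ : Measure Ω} [IsFiniteMeasure μ] {T : ℝ}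
    {ℱ : Filtration ℝ m0} {D : Set (ℝ → Ω → ℝ)} (hD : ∀ X ∈ D, PosProc μ T ℱ X) :
    ForkConvex μ T ℱ (procPolar μ T ℱ D) := by
  intro s hs h hh hh0 hh1 Y1 hY1 Y2 hY2 Y3 hY3
  rw [mem_procPolar_iff hD] at hY1 hY2 hY3
  set a : Ω → ℝ := fun ω => Y1 s ω * (h ω / Y2 s ω) with ha_def
  set b : Ω → ℝ := fun ω => Y1 s ω * ((1 - h ω) / Y3 s ω) with hb_def
  have hW : (fun t ω => if t < s then Y1 t ω
        else Y1 s ω * (h ω * (Y2 t ω / Y2 s ω) + (1 - h ω) * (Y3 t ω / Y3 s ω))) =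
      fun t ω => if t < s then Y1 t ω else a ω * Y2 t ω + b ω * Y3 t ω := by
    funext t ω
    simp only [ha_def, hb_def]
    congr 1
    ring
  rw [hW, mem_procPolar_iff hD]
  have hmY1 := (hY1.1.1 s hs).measurable
  have hmY2 := (hY2.1.1 s hs).measurable
  have hmY3 := (hY3.1.1 s hs).measurable
  have ha : Measurable[ℱ s] a := hmY1.mul (hh.measurable.div hmY2)
  have hb : Measurable[ℱ s] b := hmY1.mul ((measurable_const.sub hh.measurable).div hmY3)
  have ha0 : 0 ≤ᵐ[μ] a := by
    filter_upwards [hY1.1.2.1, hY2.1.2.1] with ω h₁ h₂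
    exact mul_nonneg (h₁ s hs) (div_nonneg (hh0 ω) (h₂ s hs))
  have hb0 : 0 ≤ᵐ[μ] b := by
    filter_upwards [hY1.1.2.1, hY3.1.2.1] with ω h₁ h₂
    exact mul_nonneg (h₁ s hs) (div_nonneg (sub_nonneg.2 (hh1 ω)) (h₂ s hs))
  have hfork_le : ∀ᵐ ω ∂μ, a ω * Y2 s ω + b ω * Y3 s ω ≤ Y1 s ω := by
    filter_upwards [hY1.1.2.1] with ω h₁
    calc a ω * Y2 s ω + b ω * Y3 s ω
        = Y1 s ω * (h ω * (Y2 s ω / Y2 s ω) + (1 - h ω) * (Y3 s ω / Y3 s ω)) := by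
          simp only [ha_def, hb_def]
          ring
      _ ≤ Y1 s ω * (h ω * 1 + (1 - h ω) * 1) := by
          refine mul_le_mul_of_nonneg_left (add_le_add ?_ ?_) (h₁ s hs)
          · exact mul_le_mul_of_nonneg_left (div_self_le_one _) (hh0 ω)
          · exact mul_le_mul_of_nonneg_left (div_self_le_one _) (sub_nonneg.2 (hh1 ω))
      _ = Y1 s ω := by ring
  refine ⟨hY1.1.fork hY2.1 hY3.1 ha.stronglyMeasurable hb.stronglyMeasurable ha0 hb0,
    fun X hX => ⟨?_, ?_⟩⟩
  · rcases hs.1.eq_or_lt with rfl | hs0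
    · filter_upwards [(hY1.2 X hX).1, hfork_le, (hD X hX).2.1] with ω h₁ h₂ h₃
      simpa using (mul_le_mul_of_nonneg_left h₂ (h₃ 0 hs)).trans h₁
    · simpa only [hs0, if_true] using (hY1.2 X hX).1
  have hmeas : ∀ {Y : ℝ → Ω → ℝ}, PosProc μ T ℱ Y → ∀ t ∈ Set.Icc (0 : ℝ) T,
      Measurable fun ω => ENNReal.ofReal (X t ω * Y t ω) := fun hY t ht =>
    (((hD X hX).mul hY).measurable_ofReal ht).mono (ℱ.le t) le_rfl
  have hsplit : ∀ t ∈ Set.Icc (0 : ℝ) T,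
      (fun ω => ENNReal.ofReal (X t ω * (a ω * Y2 t ω + b ω * Y3 t ω))) =ᵐ[μ]
        fun ω => ENNReal.ofReal (a ω) * ENNReal.ofReal (X t ω * Y2 t ω) +
          ENNReal.ofReal (b ω) * ENNReal.ofReal (X t ω * Y3 t ω) := by
    intro t ht
    filter_upwards [(hD X hX).2.1, hY2.1.2.1, hY3.1.2.1, ha0, hb0] with ω h₁ h₂ h₃ h₄ h₅
    have h₂' := mul_nonneg (h₁ t ht) (h₂ t ht)
    have h₃' := mul_nonneg (h₁ t ht) (h₃ t ht)
    rw [← ENNReal.ofReal_mul h₄, ← ENNReal.ofReal_mul h₅,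
      ← ENNReal.ofReal_add (mul_nonneg h₄ h₂') (mul_nonneg h₅ h₃')]
    congr 1
    ring
  have hafter : ∀ u t : ℝ, u ∈ Set.Icc (0 : ℝ) T → t ∈ Set.Icc (0 : ℝ) T → s ≤ u → u ≤ t →
      CondLE μ (ℱ u) (fun ω => ENNReal.ofReal (X t ω * (a ω * Y2 t ω + b ω * Y3 t ω)))
        (fun ω => ENNReal.ofReal (X u ω * (a ω * Y2 u ω + b ω * Y3 u ω))) := by
    intro u t hu ht hsu hut
    have hle := ℱ.mono hsu
    have ha' : Measurable[ℱ u] fun ω => ENNReal.ofReal (a ω) :=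
      ENNReal.measurable_ofReal.comp (ha.mono hle le_rfl)
    have hb' : Measurable[ℱ u] fun ω => ENNReal.ofReal (b ω) :=
      ENNReal.measurable_ofReal.comp (hb.mono hle le_rfl)
    have ha'' : Measurable fun ω => ENNReal.ofReal (a ω) := ha'.mono (ℱ.le u) le_rfl
    refine (CondLE.of_ae_le (hsplit t ht).le).trans
      (CondLE.trans (CondLE.add (ha''.mul (hmeas hY2.1 t ht)) (ha''.mul (hmeas hY2.1 u hu)) ?_ ?_)
        (CondLE.of_ae_le (hsplit u hu).symm.le))
    · exact ((hY2.2 X hX).2 u t hu ht hut).mul_left (ℱ.le u) (hmeas hY2.1 t ht)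
        (hmeas hY2.1 u hu) ha'
    · exact ((hY3.2 X hX).2 u t hu ht hut).mul_left (ℱ.le u) (hmeas hY3.1 t ht)
        (hmeas hY3.1 u hu) hb'
  intro u t hu ht hut
  rcases lt_or_ge t s with hts | hts
  · simpa only [hts, hut.trans_lt hts, if_true] using (hY1.2 X hX).2 u t hu ht hut
  rcases lt_or_ge u s with hus | hus
  · simp only [hts.not_gt, hus, if_true, if_false]
    refine ((hafter s t hs ht le_rfl hts).mono_sigma (ℱ.mono hus.le)).trans
      (CondLE.trans (CondLE.of_ae_le ?_) ((hY1.2 X hX).2 u s hu hs hus.le))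
    filter_upwards [hfork_le, (hD X hX).2.1] with ω h₁ h₂
    exact ENNReal.ofReal_le_ofReal (mul_le_mul_of_nonneg_left h₁ (h₂ s hs))
  · simpa only [hts.not_gt, hus.not_gt, if_false] using hafter u t hu ht hus hut

/-- If `D` is a set of positive processes containing the constant process `1`, then
the process polar `D^×` is a subset of `S₁` which is Fatou-closed, (process) solid
and fork-convex. -/
theorem procPolar_closed_solid_forkConvex {m0 : MeasurableSpace Ω} (μ : Measure Ω)
    [IsProbabilityMeasure μ] (T : ℝ) (hT : 0 < T) (ℱ : Filtration ℝ m0)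
    (hrc : ∀ t : ℝ, (ℱ t : MeasurableSpace Ω) = ⨅ (s : ℝ) (_ : t < s), ℱ s)
    (hcomp : ∀ A : Set Ω, μ A = 0 → MeasurableSet[ℱ 0] A)
    (htriv : ∀ A : Set Ω, MeasurableSet[ℱ 0] A → μ A = 0 ∨ μ A = 1)
    (D : Set (ℝ → Ω → ℝ)) (hD : ∀ X ∈ D, PosProc μ T ℱ X)
    (h1 : (fun _ _ => (1 : ℝ)) ∈ D) :
    procPolar μ T ℱ D ⊆ {X | S1mem μ T ℱ X} ∧
    FatouClosed μ T ℱ (procPolar μ T ℱ D) ∧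
    ProcSolid μ T ℱ (procPolar μ T ℱ D) ∧
    ForkConvex μ T ℱ (procPolar μ T ℱ D) := by
  exact ⟨procPolar_subset_S1 h1, fatouClosed_procPolar hT.le hD, procSolid_procPolar hT.le hD,
    forkConvex_procPolar hD⟩
end

section
/- Let C ⊆ S be fork-convex, let t ≤ t₂ be points of [0,T], and let g be a nonnegative F_{t₂}-measurable integrable random variable. Then for all Y¹, Y² ∈ C there exists Y^max ∈ C such that E[g·Δ_{t₂,t}Y^max | F_t] = max(E[g·Δ_{t₂,t}Y¹ | F_t], E[g·Δ_{t₂,t}Y² | F_t]) a.s.; in particular the family {E[g·Δ_{t₂,t}Y | F_t] : Y ∈ C} is closed under pairwise maximization. -/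
open MeasureTheory Filter Set
open scoped NNReal ENNReal

variable {Ω : Type*}

/-- The truncations in `econd` are integrable for a.e.-nonnegative measurable functions. -/
lemma integrable_min_natCast {m0 : MeasurableSpace Ω} {μ : Measure Ω} [IsFiniteMeasure μ]
    {f : Ω → ℝ} (hf : AEStronglyMeasurable f μ) (hf0 : 0 ≤ᵐ[μ] f) (n : ℕ) :
    Integrable (fun ω => min (f ω) n) μ := by
  refine Integrable.of_bound (hf.inf aestronglyMeasurable_const) (n : ℝ) ?_
  filter_upwards [hf0] with ω hω
  rw [Real.norm_eq_abs, abs_of_nonneg (le_min hω n.cast_nonneg)]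
  exact min_le_right _ _

lemma measurable_econd {m0 : MeasurableSpace Ω} (μ : Measure Ω) (m : MeasurableSpace Ω)
    (f : Ω → ℝ) : Measurable[m] (econd μ m f) :=
  Measurable.iSup fun _ => stronglyMeasurable_condExp.measurable.ennreal_ofReal

lemma econd_congr_ae {m0 : MeasurableSpace Ω} {μ : Measure Ω} (m : MeasurableSpace Ω)
    {f f' : Ω → ℝ} (h : f =ᵐ[μ] f') : econd μ m f =ᵐ[μ] econd μ m f' := by
  have key : ∀ n : ℕ, μ[fun ω => min (f ω) n | m] =ᵐ[μ] μ[fun ω => min (f' ω) n | m] :=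
    fun n => condExp_congr_ae (h.mono fun ω hω => by simp only [hω])
  filter_upwards [ae_all_iff.2 key] with ω hω
  simp only [econd, hω]

lemma econd_zero {m0 : MeasurableSpace Ω} (μ : Measure Ω) (m : MeasurableSpace Ω) :
    econd μ m (fun _ => 0) = fun _ => 0 := by
  funext ω
  simp [econd]

/-- `econd` is local: functions agreeing on a set `A` of the conditioning σ-algebra have
the same extended conditional expectation on `A`. -/
lemma econd_eq_of_eq_on {m m0 : MeasurableSpace Ω} {μ : Measure Ω} [IsFiniteMeasure μ]
    {f f' : Ω → ℝ}
    (hf : AEStronglyMeasurable f μ) (hf0 : 0 ≤ᵐ[μ] f)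
    (hf' : AEStronglyMeasurable f' μ) (hf0' : 0 ≤ᵐ[μ] f')
    {A : Set Ω} (hA : MeasurableSet[m] A) (h : ∀ᵐ ω ∂μ, ω ∈ A → f ω = f' ω) :
    ∀ᵐ ω ∂μ, ω ∈ A → econd μ m f ω = econd μ m f' ω := by
  have key : ∀ n : ℕ, ∀ᵐ ω ∂μ, ω ∈ A →
      (μ[fun ω => min (f ω) n | m]) ω = (μ[fun ω => min (f' ω) n | m]) ω := by
    intro n
    have hc : μ[A.indicator (fun ω => min (f ω) n) | m]
        =ᵐ[μ] μ[A.indicator (fun ω => min (f' ω) n) | m] := by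
      refine condExp_congr_ae ?_
      filter_upwards [h] with ω hω
      by_cases hωA : ω ∈ A
      · simp [hωA, hω hωA]
      · simp [hωA]
    filter_upwards [hc, condExp_indicator (integrable_min_natCast hf hf0 n) hA,
      condExp_indicator (integrable_min_natCast hf' hf0' n) hA] with ω h₁ h₂ h₃ hωA
    rw [h₁, h₃] at h₂
    simpa [hωA] using h₂.symm
  filter_upwards [ae_all_iff.2 key] with ω hω hωA
  simp only [econd, fun n => hω n hωA]

/-- A nonnegative supermartingale started at `0` vanishes. -/
lemma SuperMG.ae_eq_zero {m0 : MeasurableSpace Ω} {μ : Measure Ω} [IsFiniteMeasure μ] {T : ℝ}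
    {ℱ : Filtration ℝ m0} {X : ℝ → Ω → ℝ} (hX : SuperMG μ T ℱ X) (h0 : X 0 =ᵐ[μ] 0)
    {t : ℝ} (ht : t ∈ Set.Icc (0 : ℝ) T) : X t =ᵐ[μ] 0 := by
  obtain ⟨⟨_, hpos, _⟩, hint, hsup⟩ := hX
  have hnn : 0 ≤ᵐ[μ] X t := hpos.mono fun ω hω => hω t ht
  rw [← integral_eq_zero_iff_of_nonneg_ae hnn (hint t ht)]
  refine le_antisymm ?_ (integral_nonneg_of_ae hnn)
  have hle : ∫ ω, (μ[X t | ℱ 0]) ω ∂μ ≤ ∫ ω, (0 : Ω → ℝ) ω ∂μ :=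
    integral_mono_ae integrable_condExp (integrable_zero _ _ _)
      ((hsup 0 t ⟨le_rfl, ht.1.trans ht.2⟩ ht ht.1).trans h0.le)
  rwa [integral_condExp (ℱ.le 0), integral_zero'] at hle

/-- If the initial σ-algebra is trivial, a nonnegative supermartingale starts at `0` almost
surely or is initially positive almost surely. -/
lemma SuperMG.initial_eq_zero_or_pos {m0 : MeasurableSpace Ω} {μ : Measure Ω}
    [IsProbabilityMeasure μ] {T : ℝ} (hT : 0 ≤ T) {ℱ : Filtration ℝ m0} {X : ℝ → Ω → ℝ}
    (hX : SuperMG μ T ℱ X)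
    (htriv : ∀ A : Set Ω, MeasurableSet[ℱ 0] A → μ A = 0 ∨ μ A = 1) :
    X 0 =ᵐ[μ] 0 ∨ ∀ᵐ ω ∂μ, 0 < X 0 ω := by
  obtain ⟨⟨hmeas, hpos, _⟩, _, _⟩ := hX
  have h0 : (0 : ℝ) ∈ Set.Icc (0 : ℝ) T := ⟨le_rfl, hT⟩
  have hA : MeasurableSet[ℱ 0] {ω | 0 < X 0 ω} :=
    (hmeas 0 h0).measurable measurableSet_Ioi
  rcases htriv _ hA with h | h
  · left
    filter_upwards [measure_eq_zero_iff_ae_notMem.1 h, hpos] with ω h₁ h₂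
    exact le_antisymm (not_lt.1 h₁) (h₂ 0 h0)
  · right
    exact (mem_ae_iff_prob_eq_one (ℱ.le 0 _ hA)).2 h

/-- A weighted multiplicative increment of a member of `S` is measurable and nonnegative. -/
lemma SuperMG.increment {m0 : MeasurableSpace Ω} {μ : Measure Ω} {T : ℝ}
    {ℱ : Filtration ℝ m0} {X : ℝ → Ω → ℝ} (hX : SuperMG μ T ℱ X) {s t : ℝ}
    (hs : s ∈ Set.Icc (0 : ℝ) T) (ht : t ∈ Set.Icc (0 : ℝ) T)
    {g : Ω → ℝ} (hg : AEStronglyMeasurable g μ) (hg0 : ∀ ω, 0 ≤ g ω) :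
    AEStronglyMeasurable (fun ω => g ω * (X t ω / X s ω)) μ ∧
      0 ≤ᵐ[μ] fun ω => g ω * (X t ω / X s ω) := by
  obtain ⟨⟨hmeas, hpos, _⟩, _, _⟩ := hX
  have h (u : ℝ) (hu : u ∈ Set.Icc (0 : ℝ) T) : AEMeasurable (X u) μ :=
    ((hmeas u hu).mono (ℱ.le u)).measurable.aemeasurable
  refine ⟨hg.mul ((h t ht).div (h s hs)).aestronglyMeasurable, ?_⟩
  filter_upwards [hpos] with ω hω
  exact mul_nonneg (hg0 ω) (div_nonneg (hω t ht) (hω s hs))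

/-- For a fork-convex family `C` of nonnegative càdlàg supermartingales, the family
`{E[g·Δ_{t₂,t}Y | F_t] : Y ∈ C}` is closed under pairwise maximization. -/
theorem pairwise_maximization {m0 : MeasurableSpace Ω} (μ : Measure Ω)
    [IsProbabilityMeasure μ] (T : ℝ) (hT : 0 < T) (ℱ : Filtration ℝ m0)
    (hrc : ∀ t : ℝ, (ℱ t : MeasurableSpace Ω) = ⨅ (s : ℝ) (_ : t < s), ℱ s)
    (hcomp : ∀ A : Set Ω, μ A = 0 → MeasurableSet[ℱ 0] A)
    (htriv : ∀ A : Set Ω, MeasurableSet[ℱ 0] A → μ A = 0 ∨ μ A = 1)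
    (C : Set (ℝ → Ω → ℝ)) (hC : ∀ X ∈ C, SuperMG μ T ℱ X)
    (hfork : ForkConvex μ T ℱ C)
    (t t₂ : ℝ) (ht : t ∈ Set.Icc (0 : ℝ) T) (ht₂ : t₂ ∈ Set.Icc (0 : ℝ) T)
    (hle : t ≤ t₂)
    (g : Ω → ℝ) (hgm : StronglyMeasurable[ℱ t₂] g) (hg0 : ∀ ω, 0 ≤ g ω)
    (hgi : Integrable g μ) :
    ∀ Y1 ∈ C, ∀ Y2 ∈ C, ∃ Ymax ∈ C, ∀ᵐ ω ∂μ,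
      econd μ (ℱ t) (fun ω' => g ω' * (Ymax t₂ ω' / Ymax t ω')) ω =
        max (econd μ (ℱ t) (fun ω' => g ω' * (Y1 t₂ ω' / Y1 t ω')) ω)
            (econd μ (ℱ t) (fun ω' => g ω' * (Y2 t₂ ω' / Y2 t ω')) ω) := by
  intro Y1 hY1 Y2 hY2
  have h0T : (0 : ℝ) ∈ Set.Icc (0 : ℝ) T := ⟨le_rfl, hT.le⟩
  have hga : AEStronglyMeasurable g μ := hgi.aestronglyMeasurable
  have hzero : ∀ Y ∈ C, Y 0 =ᵐ[μ] 0 →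
      econd μ (ℱ t) (fun ω' => g ω' * (Y t₂ ω' / Y t ω')) =ᵐ[μ] fun _ => 0 := by
    intro Y hY hY0
    rw [← econd_zero μ (ℱ t)]
    refine econd_congr_ae _ ?_
    filter_upwards [(hC Y hY).ae_eq_zero hY0 ht] with ω hω
    simp [hω]
  rcases (hC Y1 hY1).initial_eq_zero_or_pos hT.le htriv with h1 | h1
  · refine ⟨Y2, hY2, ?_⟩
    filter_upwards [hzero Y1 hY1 h1] with ω hω
    simp [hω]
  rcases (hC Y2 hY2).initial_eq_zero_or_pos hT.le htriv with h2 | h2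
  · refine ⟨Y1, hY1, ?_⟩
    filter_upwards [hzero Y2 hY2 h2] with ω hω
    simp [hω]
  -- `Z` is positive at time `t` wherever `Y1` or `Y2` is; it is the process to be forked at `t`.
  obtain ⟨Z, hZC, hZ⟩ : ∃ Z ∈ C, ∀ ω, Z t ω =
      Y1 0 ω * (1 / 2 * (Y1 t ω / Y1 0 ω) + (1 - 1 / 2) * (Y2 t ω / Y2 0 ω)) :=
    ⟨_, hfork 0 h0T (fun _ => 1 / 2) stronglyMeasurable_const (fun _ => by norm_num)
      (fun _ => by norm_num) Y1 hY1 Y1 hY1 Y2 hY2, fun ω => if_neg (not_lt.2 ht.1)⟩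
  have hZpos : ∀ᵐ ω ∂μ, (Y1 t ω ≠ 0 → Z t ω ≠ 0) ∧ (Y2 t ω ≠ 0 → Z t ω ≠ 0) := by
    filter_upwards [h1, h2, (hC Y1 hY1).1.2.1, (hC Y2 hY2).1.2.1] with ω h1 h2 p1 p2
    have q1 := div_nonneg (p1 t ht) h1.le
    have q2 := div_nonneg (p2 t ht) h2.le
    rw [hZ]
    constructor <;> intro hne
    · have : 0 < Y1 t ω / Y1 0 ω := div_pos (lt_of_le_of_ne (p1 t ht) hne.symm) h1
      exact (mul_pos h1 (by linarith)).ne'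
    · have : 0 < Y2 t ω / Y2 0 ω := div_pos (lt_of_le_of_ne (p2 t ht) hne.symm) h2
      exact (mul_pos h1 (by linarith)).ne'
  set f1 : Ω → ℝ := fun ω' => g ω' * (Y1 t₂ ω' / Y1 t ω')
  set f2 : Ω → ℝ := fun ω' => g ω' * (Y2 t₂ ω' / Y2 t ω')
  set A : Set Ω := {ω | econd μ (ℱ t) f2 ω ≤ econd μ (ℱ t) f1 ω}
  have hA : MeasurableSet[ℱ t] A :=
    measurableSet_le (mδ := ℱ t) (measurable_econd μ (ℱ t) f2) (measurable_econd μ (ℱ t) f1)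
  have hmem := hfork t ht (A.indicator fun _ => 1) (stronglyMeasurable_const.indicator hA)
    (fun ω => indicator_nonneg (fun _ _ => zero_le_one) ω)
    (fun ω => indicator_le_self' (fun _ _ => zero_le_one) ω) Z hZC Y1 hY1 Y2 hY2
  refine ⟨_, hmem, ?_⟩
  obtain ⟨m1, p1⟩ := (hC Y1 hY1).increment ht ht₂ hga hg0
  obtain ⟨m2, p2⟩ := (hC Y2 hY2).increment ht ht₂ hga hg0
  obtain ⟨m, p⟩ := (hC _ hmem).increment ht ht₂ hga hg0
  have e1 := econd_eq_of_eq_on m p m1 p1 hA <| by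
    filter_upwards [hZpos] with ω hω hωA
    by_cases hy : Y1 t ω = 0
    · simp [hωA, hy]
    · simp [hωA, hy, hω.1 hy, not_lt.2 hle]
  have e2 := econd_eq_of_eq_on m p m2 p2 hA.compl <| by
    filter_upwards [hZpos] with ω hω hωA
    by_cases hy : Y2 t ω = 0
    · simp [Set.indicator_of_notMem hωA, hy]
    · simp [Set.indicator_of_notMem hωA, hy, hω.2 hy, not_lt.2 hle]
  filter_upwards [e1, e2] with ω h₁ h₂
  by_cases hωA : ω ∈ A
  · rw [h₁ hωA, max_eq_left hωA]
  · rw [h₂ hωA, max_eq_right (not_le.1 hωA).le]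
end
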